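/- Let ν, μ be nonnegative integers with μ − ν odd and positive, let n ≥ 1, and let 0 < x_1 < ⋯ < x_n and w_1, …, w_n > 0 form an n-point Gaussian quadrature rule for w_{μ,ν}. Then for every polynomial f ∈ ℂ[x] of degree at most 4n + μ and every ω > 0, the Abel limit (H_ν f)(ω) exists and (H_ν f)(ω) = (Q_{2n,μ} f)(ω). -/

import Mathlib

open MeasureTheory Filter Set Polynomial
open scoped Classical

noncomputable section

/-- The Abel limit of `∫₀^∞ g(x) dx` is `L`: for every `s > 0` the integral
`∫₀^∞ e^{-s x} g(x) dx` converges and these integrals tend to `L` as `s → 0⁺`. -/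
def HasAbelLimit (g : ℝ → ℂ) (L : ℂ) : Prop :=
  (∀ s : ℝ, 0 < s →
    IntegrableOn (fun x : ℝ => Complex.exp (-(s : ℂ) * (x : ℂ)) * g x) (Set.Ioi 0)) ∧
  Tendsto (fun s : ℝ => ∫ x in Set.Ioi (0:ℝ), Complex.exp (-(s : ℂ) * (x : ℂ)) * g x)
    (nhdsWithin 0 (Set.Ioi 0)) (nhds L)

/-- Bessel function of the first kind of order `ν`, for `x > 0`, with the convention
`1/Γ(z) = 0` at nonpositive integers `z` (automatic since `Real.Gamma` vanishes there). -/
def besselJ (ν x : ℝ) : ℝ :=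
  ∑' k : ℕ, ((-1 : ℝ) ^ k / ((k.factorial : ℝ) * Real.Gamma (ν + k + 1))) *
    (x / 2) ^ (ν + 2 * (k : ℝ))

/-- Modified Bessel function of the second kind of order `ν`, for `x > 0`. -/
def besselK (ν x : ℝ) : ℝ :=
  ∫ t in Set.Ioi (0:ℝ), Real.exp (-x * Real.cosh t) * Real.cosh (ν * t)

/-- The weight function `w_{μ,ν}` on `(0,∞)`. -/
def weightW (μ ν : ℝ) (x : ℝ) : ℝ :=
  if ∃ m : ℤ, μ - ν = 2 * m then (1/2) * x ^ ((μ - 1)/2) * besselK ν (Real.sqrt x)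
  else (1/2) * x ^ (μ/2) * besselK ν (Real.sqrt x)

/-- `0 < x_1 < ⋯ < x_n` together with positive weights `w_1, …, w_n` form an `n`-point
Gaussian quadrature rule for `w_{μ,ν}`. -/
def IsGaussRule (μ ν : ℝ) (n : ℕ) (xs ws : Fin n → ℝ) : Prop :=
  StrictMono xs ∧ (∀ j, 0 < xs j) ∧ (∀ j, 0 < ws j) ∧
  ∀ p : Polynomial ℝ, p.natDegree ≤ 2 * n - 1 →
    ∑ j, ws j * p.eval (xs j) = ∫ x in Set.Ioi (0:ℝ), weightW μ ν x * p.eval x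

/-- `κ = μ` if `μ - ν` is even and `κ = μ + 1` if `μ - ν` is odd. -/
def kappaQ (μ ν : ℕ) : ℝ := if Even (μ - ν) then (μ : ℝ) else (μ : ℝ) + 1

/-- The boundary weights `ŵ_k⁰` of the generalized Gauss–Radau rule. -/
def wHat0 (μ ν : ℕ) {n : ℕ} (xs ws : Fin n → ℝ) (k : ℕ) : ℝ :=
  (1 / (k.factorial : ℝ)) *
    (2 ^ k * Real.Gamma (((ν : ℝ) + k + 1)/2) / Real.Gamma (((ν : ℝ) - k + 1)/2)
      - (2 / Real.pi) * Real.cos (((k : ℝ) - ν) * Real.pi / 2) *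
          ∑ j, ws j * (xs j) ^ (((k : ℝ) - kappaQ μ ν)/2))

/-- The generalized Gauss–Radau rule `(Q_{2n,μ} f)(ω)`. -/
def QRule (μ ν : ℕ) {n : ℕ} (xs ws : Fin n → ℝ) (f : ℂ → ℂ) (ω : ℝ) : ℂ :=
  (1 / (ω : ℂ)) *
    ((∑ k ∈ Finset.range μ, (wHat0 μ ν xs ws k : ℂ) / (ω : ℂ) ^ k * iteratedDeriv k f 0)
      + ∑ j, ((ws j * (xs j) ^ (-(kappaQ μ ν)/2) / Real.pi : ℝ) : ℂ) *
          (Complex.exp (-(ν : ℂ) * (Real.pi : ℂ) * Complex.I / 2) *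
              f (Complex.I * (Real.sqrt (xs j) : ℂ) / (ω : ℂ))
            + Complex.exp ((ν : ℂ) * (Real.pi : ℂ) * Complex.I / 2) *
              f (-Complex.I * (Real.sqrt (xs j) : ℂ) / (ω : ℂ))))

/-- `P` is a monic polynomial of degree `m` orthogonal with respect to `x^μ J_ν(x)`
on `(0,∞)`, all integrals taken in the Abel-limit sense. -/
def MonicOrthoBessel (μ ν : ℝ) (m : ℕ) (P : Polynomial ℂ) : Prop :=
  P.Monic ∧ P.natDegree = m ∧
  ∀ k < m, HasAbelLimit
    (fun x : ℝ => P.eval (x : ℂ) * ((x ^ ((k : ℝ) + μ) : ℝ) : ℂ) * (besselJ ν x : ℂ)) 0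

/-- `φ` is the monic real polynomial of degree `m` orthogonal to all lower powers
with respect to the weight `w_{μ,ν}` on `(0,∞)`. -/
def IsMonicOrthoW (μ ν : ℝ) (m : ℕ) (φ : Polynomial ℝ) : Prop :=
  φ.Monic ∧ φ.natDegree = m ∧
  ∀ k < m, ∫ x in Set.Ioi (0:ℝ), weightW μ ν x * φ.eval x * x ^ k = 0


/-- The integral `∫₀^∞ cosh(a u) / cosh(u)^(k+1) du`. -/
def sechMoment (k : ℕ) (a : ℝ) : ℝ :=
  ∫ u in Ioi (0:ℝ), Real.cosh (a * u) / Real.cosh u ^ (k + 1)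

theorem tendsto_sinh_atTop : Tendsto Real.sinh atTop atTop :=
  tendsto_atTop_mono' _ ((eventually_ge_atTop 0).mono fun _ hx => Real.self_le_sinh_iff.2 hx)
    tendsto_id

theorem tendsto_inv_cosh_atTop : Tendsto (fun u : ℝ => (Real.cosh u)⁻¹) atTop (nhds 0) :=
  tendsto_inv_atTop_zero.comp
    (tendsto_atTop_mono (fun x => (Real.sinh_lt_cosh x).le) tendsto_sinh_atTop)

theorem hasDerivAt_arctan_sinh (u : ℝ) :
    HasDerivAt (fun u => Real.arctan (Real.sinh u)) (Real.cosh u)⁻¹ u := by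
  convert (Real.hasDerivAt_sinh u).arctan using 1
  rw [add_comm, ← Real.cosh_sq]
  field_simp [(Real.cosh_pos u).ne']

theorem tendsto_arctan_sinh :
    Tendsto (fun u => Real.arctan (Real.sinh u)) atTop (nhds (Real.pi / 2)) :=
  (tendsto_nhds_of_tendsto_nhdsWithin Real.tendsto_arctan_atTop).comp tendsto_sinh_atTop

theorem integrableOn_inv_cosh : IntegrableOn (fun u : ℝ => (Real.cosh u)⁻¹) (Ioi 0) :=
  integrableOn_Ioi_deriv_of_nonneg' (fun u _ => hasDerivAt_arctan_sinh u)
    (fun u _ => (inv_pos.2 (Real.cosh_pos u)).le) tendsto_arctan_sinh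

theorem sechMoment_zero_zero : sechMoment 0 0 = Real.pi / 2 := by
  have := integral_Ioi_of_hasDerivAt_of_nonneg' (fun u (_ : u ∈ Ici (0:ℝ)) => hasDerivAt_arctan_sinh u)
    (fun u _ => (inv_pos.2 (Real.cosh_pos u)).le) tendsto_arctan_sinh
  simpa [sechMoment] using this

theorem cosh_mul_le (k : ℕ) (a u : ℝ) (ha : |a| ≤ k) :
    Real.cosh (a * u) ≤ (2 * Real.cosh u) ^ k := by
  rw [← Real.cosh_abs, abs_mul]
  calc Real.cosh (|a| * |u|) ≤ Real.exp (|a| * |u|) := by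
        rw [← Real.cosh_add_sinh]
        linarith [Real.sinh_nonneg_iff.2 (mul_nonneg (abs_nonneg a) (abs_nonneg u))]
    _ ≤ Real.exp (k * |u|) := Real.exp_le_exp.2 (by gcongr)
    _ = Real.exp |u| ^ k := by rw [← Real.exp_nat_mul]
    _ ≤ (2 * Real.cosh u) ^ k := by
        gcongr
        rw [← Real.cosh_abs u, Real.cosh_eq]
        linarith [Real.exp_pos (-|u|)]

theorem cosh_mul_div_le (k : ℕ) (a u : ℝ) (ha : |a| ≤ k) :
    Real.cosh (a * u) / Real.cosh u ^ (k + 1) ≤ 2 ^ k * (Real.cosh u)⁻¹ := by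
  have hc := Real.cosh_pos u
  rw [div_le_iff₀ (by positivity)]
  refine (cosh_mul_le k a u ha).trans (le_of_eq ?_)
  rw [mul_pow, pow_succ]
  field_simp

theorem integrableOn_sechMoment (k : ℕ) (a : ℝ) (ha : |a| ≤ k) :
    IntegrableOn (fun u => Real.cosh (a * u) / Real.cosh u ^ (k + 1)) (Ioi 0) := by
  refine Integrable.mono' (integrableOn_inv_cosh.const_mul (2 ^ k)) ?_ ?_
  · refine (Continuous.div (by fun_prop) (by fun_prop) fun u => ?_).aestronglyMeasurable
    exact pow_ne_zero _ (Real.cosh_pos u).ne'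
  · refine .of_forall fun u => ?_
    have := Real.cosh_pos u
    have := Real.cosh_pos (a * u)
    rw [Real.norm_of_nonneg (by positivity)]
    exact cosh_mul_div_le k a u ha

theorem sechMoment_neg (k : ℕ) (a : ℝ) : sechMoment k (-a) = sechMoment k a := by
  simp [sechMoment]

theorem sechMoment_succ_add_one (k : ℕ) (a : ℝ) (ha : |a| ≤ k) :
    (k + 1) * sechMoment (k + 1) (a + 1) = (k + 1 + a) * sechMoment k a := by
  have ha' : |a + 1| ≤ ((k + 1 : ℕ) : ℝ) := by
    push_cast
    exact (abs_add_le _ _).trans (by simpa using ha)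
  have h1 := (integrableOn_sechMoment k a ha).const_mul (k + 1 + a)
  have h2 := (integrableOn_sechMoment (k + 1) (a + 1) ha').const_mul ((k : ℝ) + 1)
  have hd : ∀ u ∈ Ici (0:ℝ), HasDerivAt (fun u => Real.sinh (a * u) / Real.cosh u ^ (k + 1))
      ((k + 1 + a) * (Real.cosh (a * u) / Real.cosh u ^ (k + 1)) -
        (k + 1) * (Real.cosh ((a + 1) * u) / Real.cosh u ^ (k + 1 + 1))) u := by
    intro u _
    have hc := (Real.cosh_pos u).ne'
    have hs : HasDerivAt (fun u => Real.sinh (a * u)) (Real.cosh (a * u) * a) u := by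
      simpa using ((hasDerivAt_id u).const_mul a).sinh
    refine (hs.div ((Real.hasDerivAt_cosh u).pow (k + 1)) (pow_ne_zero _ hc)).congr_deriv ?_
    rw [show (a + 1) * u = a * u + u by ring, Real.cosh_add]
    simp only [Pi.pow_apply, Nat.add_sub_cancel]
    field_simp
    push_cast
    ring
  have ht : Tendsto (fun u => Real.sinh (a * u) / Real.cosh u ^ (k + 1)) atTop (nhds 0) := by
    refine squeeze_zero_norm (fun u => ?_)
      (by simpa using tendsto_inv_cosh_atTop.const_mul ((2:ℝ) ^ k))
    refine le_trans ?_ (cosh_mul_div_le k a u ha)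
    have hc := Real.cosh_pos u
    rw [norm_div, Real.norm_eq_abs, Real.norm_of_nonneg (by positivity)]
    gcongr
    rw [Real.abs_sinh, ← Real.cosh_abs (a * u)]
    exact (Real.sinh_lt_cosh _).le
  have := integral_Ioi_of_hasDerivAt_of_tendsto' hd (h1.sub h2) ht
  rw [integral_sub h1 h2, integral_const_mul, integral_const_mul] at this
  simp only [mul_zero, Real.sinh_zero, zero_div, sub_zero] at this
  simp only [sechMoment]
  linarith

theorem sechMoment_eq_Gamma (m n : ℕ) :
    ((n + 2 * m).factorial : ℝ) * sechMoment (n + 2 * m) n =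
      2 ^ (n + 2 * m) / 2 * Real.Gamma (m + 1 / 2) * Real.Gamma (n + m + 1 / 2) := by
  induction n with
  | zero =>
    induction m with
    | zero =>
      simp only [Nat.cast_zero, zero_add, mul_zero, Nat.factorial_zero, sechMoment_zero_zero,
        pow_zero, Real.Gamma_one_half_eq]
      rw [mul_assoc, Real.mul_self_sqrt Real.pi_pos.le]
      simp; ring
    | succ m ih =>
      have h1 := sechMoment_succ_add_one (2 * m) 0 (by simp)
      have h2 := sechMoment_succ_add_one (2 * m + 1) (-1) (by simp)
      rw [zero_add, ← sechMoment_neg] at h1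
      rw [neg_add_cancel] at h2
      have hG := Real.Gamma_add_one (s := (m:ℝ) + 1 / 2) (by positivity)
      simp only [Nat.cast_zero, zero_add] at ih ⊢
      rw [show 2 * (m + 1) = 2 * m + 1 + 1 by ring, Nat.factorial_succ, Nat.factorial_succ]
      push_cast at h1 h2 ⊢
      rw [show (m:ℝ) + 1 + 1 / 2 = m + 1 / 2 + 1 by ring, hG]
      have e : (2 * (m:ℝ) + 1 + 1) * (2 * m + 1) * sechMoment (2 * m + 1 + 1) 0 =
          (2 * m + 1) * (2 * m + 1) * sechMoment (2 * m) 0 := by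
        linear_combination (2 * (m:ℝ) + 1) * h2 + (2 * (m:ℝ) + 1) * h1
      linear_combination ((2 * m).factorial : ℝ) * e + (2 * (m:ℝ) + 1) * (2 * m + 1) * ih
  | succ n ih =>
    have h1 := sechMoment_succ_add_one (n + 2 * m) n (by simp)
    have hG := Real.Gamma_add_one (s := (n:ℝ) + m + 1 / 2) (by positivity)
    rw [show n + 1 + 2 * m = n + 2 * m + 1 by ring, Nat.factorial_succ]
    push_cast at h1 ⊢
    rw [show (n:ℝ) + 1 + m + 1 / 2 = n + m + 1 / 2 + 1 by ring, hG]
    linear_combination ((n + 2 * m).factorial : ℝ) * h1 + (2 * (n:ℝ) + 2 * m + 1) * ih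

theorem integral_rpow_mul_besselK (n : ℕ) (q : ℝ) (k : ℕ) (hq : 2 * (q + 1) = k + 1) (hnk : n ≤ k) :
    ∫ x in Ioi (0:ℝ), 1 / 2 * x ^ q * besselK n (Real.sqrt x) =
      (k.factorial : ℝ) * sechMoment k n := by
  set F : ℝ → ℝ → ℝ := fun x u =>
    1 / 2 * x ^ q * (Real.exp (-Real.sqrt x * Real.cosh u) * Real.cosh (n * u)) with hF
  have hq1 : -1 < q := by
    have : (0:ℝ) ≤ k := by positivity
    linarith
  have hFeq : ∀ u x, F x u = 1 / 2 * Real.cosh (n * u) *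
      (x ^ q * Real.exp (-Real.cosh u * x ^ (1 / 2 : ℝ))) := by
    intro u x
    simp only [hF, Real.sqrt_eq_rpow]
    ring_nf
  have hint : ∀ u, ∫ x in Ioi (0:ℝ), F x u =
      (k.factorial : ℝ) * (Real.cosh (n * u) / Real.cosh u ^ (k + 1)) := by
    intro u
    have hc := Real.cosh_pos u
    simp_rw [hFeq]
    rw [integral_const_mul, integral_rpow_mul_exp_neg_mul_rpow (by norm_num) hq1 hc,
      show (q + 1) / (1 / 2) = (k:ℝ) + 1 by linarith, Real.Gamma_nat_eq_factorial,
      show -(q + 1) / (1 / 2) = -((k + 1 : ℕ) : ℝ) by push_cast; linarith,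
      Real.rpow_neg hc.le, Real.rpow_natCast]
    field_simp
  have hnn : ∀ u, ∀ x ∈ Ioi (0:ℝ), 0 ≤ F x u := by
    intro u x hx
    have := Real.cosh_pos (n * u)
    have : 0 ≤ x ^ q := Real.rpow_nonneg (le_of_lt hx) _
    positivity
  have hI : Integrable (Function.uncurry F)
      ((volume.restrict (Ioi 0)).prod (volume.restrict (Ioi 0))) := by
    refine (integrable_prod_iff' ?_).2 ⟨?_, ?_⟩
    · refine Measurable.aestronglyMeasurable ?_
      simp only [hF, Function.uncurry_def]
      have : Measurable Real.cosh := Real.continuous_cosh.measurable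
      fun_prop
    · refine .of_forall fun u => ?_
      simp only [Function.uncurry_apply_pair, hFeq]
      exact (integrableOn_rpow_mul_exp_neg_mul_rpow hq1 (by norm_num) (Real.cosh_pos u)).const_mul _
    · have : (fun u => ∫ x in Ioi (0:ℝ), ‖Function.uncurry F (x, u)‖) =
          fun u => (k.factorial : ℝ) * (Real.cosh (n * u) / Real.cosh u ^ (k + 1)) := by
        ext u
        rw [← hint]
        exact setIntegral_congr_fun measurableSet_Ioi fun x hx => Real.norm_of_nonneg (hnn u x hx)
      rw [this]
      exact (integrableOn_sechMoment k n (by simpa using hnk)).const_mul _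
  calc _ = ∫ x in Ioi (0:ℝ), ∫ u in Ioi (0:ℝ), F x u := by
        simp only [hF, besselK, integral_const_mul]
    _ = ∫ u in Ioi (0:ℝ), ∫ x in Ioi (0:ℝ), F x u := integral_integral_swap hI
    _ = _ := by simp_rw [hint]; rw [integral_const_mul, sechMoment]

theorem moment_weightW (ν μ m : ℕ) (hodd : Odd (μ - ν)) (l : ℕ)
    (hl : μ + 1 + 2 * m = ν + 2 * l) :
    ∫ x in Ioi (0:ℝ), weightW μ ν x * x ^ m =
      2 ^ (ν + 2 * l) / 2 * Real.Gamma (l + 1 / 2) * Real.Gamma (ν + l + 1 / 2) := by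
  have hne : ¬ ∃ r : ℤ, (μ : ℝ) - ν = 2 * r := by
    rintro ⟨r, hr⟩
    have : (μ : ℤ) - ν = 2 * r := by exact_mod_cast hr
    obtain ⟨t, ht⟩ := hodd
    omega
  rw [← sechMoment_eq_Gamma,
    ← integral_rpow_mul_besselK ν (μ / 2 + m) (ν + 2 * l) _ (Nat.le_add_right _ _)]
  · refine setIntegral_congr_fun measurableSet_Ioi fun x hx => ?_
    simp only [weightW, if_neg hne]
    rw [Real.rpow_add hx, Real.rpow_natCast]
    ring
  · rw [← hl]; push_cast; ring

theorem integral_exp_int_mul_I (m : ℤ) :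
    ∫ θ in (0:ℝ)..(2 * Real.pi), Complex.exp ((m : ℂ) * Complex.I * (θ : ℂ)) =
      if m = 0 then 2 * (Real.pi : ℂ) else 0 := by
  split_ifs with h
  · simp [h]
  · have hm : (m : ℂ) * Complex.I ≠ 0 := mul_ne_zero (by exact_mod_cast h) Complex.I_ne_zero
    rw [integral_exp_mul_complex hm]
    have : (m : ℂ) * Complex.I * ((2 * Real.pi : ℝ) : ℂ) = m * (2 * Real.pi * Complex.I) := by
      push_cast; ring
    rw [this, Complex.exp_int_mul_two_pi_mul_I]
    simp

theorem besselJ_natCast (n : ℕ) (x : ℝ) :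
    (besselJ n x : ℂ) = ∑' a : ℕ,
      ((-((x : ℂ) / 2)) ^ a / (a.factorial : ℂ)) *
        (((x : ℂ) / 2) ^ (n + a) / ((n + a).factorial : ℂ)) := by
  rw [besselJ, Complex.ofReal_tsum]
  refine tsum_congr fun a => ?_
  have h1 : (n : ℝ) + 2 * a = ((n + 2 * a : ℕ) : ℝ) := by push_cast; ring
  have h2 : Real.Gamma ((n : ℝ) + a + 1) = ((n + a).factorial : ℝ) := by
    rw [← Real.Gamma_nat_eq_factorial]; push_cast; rfl
  rw [h1, h2, Real.rpow_natCast, neg_pow ((x : ℂ) / 2)]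
  push_cast
  rw [div_mul_div_comm, div_mul_eq_mul_div]
  congr 1
  ring

theorem summable_norm_expTerm_mul (y z : ℂ) : Summable fun p : ℕ × ℕ =>
    ‖(y ^ p.1 / (p.1.factorial : ℂ)) * (z ^ p.2 / (p.2.factorial : ℂ))‖ :=
  Summable.mul_norm (f := fun a : ℕ => y ^ a / (a.factorial : ℂ))
    (g := fun a : ℕ => z ^ a / (a.factorial : ℂ))
    (NormedSpace.norm_expSeries_div_summable y) (NormedSpace.norm_expSeries_div_summable z)

theorem hasSum_expTerm_mul (y z : ℂ) : HasSum (fun p : ℕ × ℕ =>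
    (y ^ p.1 / (p.1.factorial : ℂ)) * (z ^ p.2 / (p.2.factorial : ℂ)))
      (Complex.exp y * Complex.exp z) := by
  rw [Complex.exp_eq_exp_ℂ]
  exact HasSum.mul (f := fun a : ℕ => y ^ a / (a.factorial : ℂ))
    (g := fun a : ℕ => z ^ a / (a.factorial : ℂ)) (NormedSpace.expSeries_div_hasSum_exp y)
    (NormedSpace.expSeries_div_hasSum_exp z) (summable_norm_expTerm_mul y z).of_norm

theorem hasSum_generating (n : ℕ) (y : ℂ) (θ : ℝ) :
    HasSum (fun p : ℕ × ℕ => ((-y) ^ p.1 / (p.1.factorial : ℂ)) * (y ^ p.2 / (p.2.factorial : ℂ)) *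
        Complex.exp ((((n : ℤ) + p.1 - p.2 : ℤ) : ℂ) * Complex.I * θ))
      (Complex.exp ((n : ℂ) * Complex.I * θ) *
        Complex.exp (-Complex.I * (2 * y) * Complex.sin θ)) := by
  have h := (hasSum_expTerm_mul (-y * Complex.exp (Complex.I * θ))
    (y * Complex.exp (-(Complex.I * θ)))).mul_left (Complex.exp ((n : ℂ) * Complex.I * θ))
  rw [← Complex.exp_add (-y * Complex.exp (Complex.I * θ))] at h
  have he : -y * Complex.exp (Complex.I * θ) + y * Complex.exp (-(Complex.I * θ)) =
      -Complex.I * (2 * y) * Complex.sin θ := by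
    rw [Complex.sin, show Complex.I * (θ : ℂ) = θ * Complex.I by ring, ← neg_mul]
    linear_combination (y * (Complex.exp (-θ * Complex.I) -
      Complex.exp (θ * Complex.I))) * Complex.I_sq
  rw [he] at h
  refine (congrArg (fun F => HasSum F _) (funext fun p => ?_)).mpr h
  have : Complex.exp ((((n : ℤ) + p.1 - p.2 : ℤ) : ℂ) * Complex.I * θ) =
      Complex.exp ((n : ℂ) * Complex.I * θ) *
        (Complex.exp (Complex.I * θ) ^ p.1 * Complex.exp (-(Complex.I * θ)) ^ p.2) := by
    rw [← Complex.exp_nat_mul, ← Complex.exp_nat_mul, ← Complex.exp_add, ← Complex.exp_add]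
    congr 1
    push_cast
    ring
  rw [this, mul_pow, mul_pow]
  ring

theorem integral_generating_term (n : ℕ) (c : ℂ) (p : ℕ × ℕ) :
    ∫ θ in (0:ℝ)..(2 * Real.pi),
        c * Complex.exp ((((n : ℤ) + p.1 - p.2 : ℤ) : ℂ) * Complex.I * θ) =
      if p.2 = n + p.1 then c * (2 * (Real.pi : ℂ)) else 0 := by
  rw [intervalIntegral.integral_const_mul, integral_exp_int_mul_I, mul_ite, mul_zero]
  exact if_congr (by omega) rfl rfl

theorem norm_exp_int_mul_I (m : ℤ) (θ : ℝ) : ‖Complex.exp ((m : ℂ) * Complex.I * θ)‖ = 1 := by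
  rw [show (m : ℂ) * Complex.I * θ = ((m * θ : ℝ) : ℂ) * Complex.I by push_cast; ring]
  exact Complex.norm_exp_ofReal_mul_I _

theorem besselJ_eq_integral (n : ℕ) (x : ℝ) :
    (besselJ n x : ℂ) = (2 * (Real.pi : ℂ))⁻¹ * ∫ θ in (0:ℝ)..(2 * Real.pi),
      Complex.exp ((n : ℂ) * Complex.I * θ) * Complex.exp (-Complex.I * x * Complex.sin θ) := by
  obtain ⟨y, hy⟩ : ∃ y : ℂ, y = (x : ℂ) / 2 := ⟨_, rfl⟩
  have hx : (x : ℂ) = 2 * y := by rw [hy]; ring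
  obtain ⟨c, hc⟩ : ∃ c : ℕ × ℕ → ℂ, c = fun p =>
    ((-y) ^ p.1 / (p.1.factorial : ℂ)) * (y ^ p.2 / (p.2.factorial : ℂ)) := ⟨_, rfl⟩
  have hcs : Summable fun p => ‖c p‖ := by
    rw [hc]
    exact summable_norm_expTerm_mul (-y) y
  have key := intervalIntegral.hasSum_integral_of_dominated_convergence (μ := volume)
    (a := 0) (b := 2 * Real.pi)
    (F := fun p θ => c p * Complex.exp ((((n : ℤ) + p.1 - p.2 : ℤ) : ℂ) * Complex.I * θ))
    (f := fun θ : ℝ => Complex.exp ((n : ℂ) * Complex.I * θ) *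
        Complex.exp (-Complex.I * (2 * y) * Complex.sin θ)) (fun p _ => ‖c p‖)
    (fun p => Continuous.aestronglyMeasurable (by fun_prop))
    (fun p => .of_forall fun θ _ => by rw [norm_mul, norm_exp_int_mul_I, mul_one])
    (.of_forall fun θ _ => hcs) intervalIntegrable_const
    (.of_forall fun θ _ => by rw [hc]; exact hasSum_generating n y θ)
  have hinj : Function.Injective (fun a : ℕ => (a, n + a)) := fun a b h => (Prod.ext_iff.1 h).1
  simp_rw [integral_generating_term] at key
  rw [← hinj.hasSum_iff] at key
  · rw [hx, ← key.tsum_eq, besselJ_natCast, ← tsum_mul_left]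
    refine tsum_congr fun a => ?_
    have hpi : (2 * Real.pi : ℂ) ≠ 0 := by exact_mod_cast Real.two_pi_pos.ne'
    rw [Function.comp_apply, if_pos rfl, mul_comm (c _), inv_mul_cancel_left₀ hpi, hc, ← hy]
  · rintro ⟨a, b⟩ hp
    refine if_neg fun h => hp ⟨a, ?_⟩
    simpa using h.symm

/-- The integral `(2π)⁻¹ ∫₀^{2π} e^{inθ} / (s + i sin θ)^(k+1) dθ`. -/
def angularIntegral (k n : ℕ) (s : ℝ) : ℂ :=
  (2 * (Real.pi : ℂ))⁻¹ * ∫ θ in (0:ℝ)..(2 * Real.pi),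
    Complex.exp ((n : ℂ) * Complex.I * θ) / ((s : ℂ) + Complex.I * Complex.sin θ) ^ (k + 1)

theorem re_add_I_mul_sin (s ω θ : ℝ) :
    ((s : ℂ) + Complex.I * (ω * Complex.sin θ)).re = s := by
  rw [← Complex.ofReal_sin, ← Complex.ofReal_mul]
  simp

theorem add_I_mul_sin_ne_zero {s : ℝ} (hs : 0 < s) (θ : ℝ) :
    (s : ℂ) + Complex.I * Complex.sin θ ≠ 0 := by
  intro h
  have := re_add_I_mul_sin s 1 θ
  rw [Complex.ofReal_one, one_mul, h] at this
  simp at this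
  linarith

theorem intervalIntegrable_angular {s : ℝ} (hs : 0 < s) (k n : ℕ) :
    IntervalIntegrable (fun θ : ℝ => Complex.exp ((n : ℂ) * Complex.I * θ) /
      ((s : ℂ) + Complex.I * Complex.sin θ) ^ (k + 1)) volume 0 (2 * Real.pi) :=
  (Continuous.div (by fun_prop) (by fun_prop)
    fun θ => pow_ne_zero _ (add_I_mul_sin_ne_zero hs θ)).intervalIntegrable _ _

theorem angularIntegral_succ {s : ℝ} (hs : 0 < s) (k n : ℕ) :
    ((k : ℂ) + 1) * (1 + (s : ℂ) ^ 2) * angularIntegral (k + 1) n s =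
      ((n : ℂ) - k) * angularIntegral k (n + 1) s +
        s * ((n : ℂ) + k + 1) * angularIntegral k n s := by
  have i1 := (intervalIntegrable_angular hs (k + 1) n).const_mul
    (((k : ℂ) + 1) * (1 + (s : ℂ) ^ 2))
  have i2 := (intervalIntegrable_angular hs k (n + 1)).const_mul ((n : ℂ) - k)
  have i3 := (intervalIntegrable_angular hs k n).const_mul ((s : ℂ) * ((n : ℂ) + k + 1))
  have hd : ∀ θ ∈ uIcc (0:ℝ) (2 * Real.pi), HasDerivAt
      (fun θ : ℝ => -Complex.I * (Complex.exp (Complex.I * θ) + s) *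
        Complex.exp ((n : ℂ) * Complex.I * θ) / ((s : ℂ) + Complex.I * Complex.sin θ) ^ (k + 1))
      (((n : ℂ) - k) * (Complex.exp (((n + 1 : ℕ) : ℂ) * Complex.I * θ) /
          ((s : ℂ) + Complex.I * Complex.sin θ) ^ (k + 1)) +
        (s : ℂ) * ((n : ℂ) + k + 1) * (Complex.exp ((n : ℂ) * Complex.I * θ) /
          ((s : ℂ) + Complex.I * Complex.sin θ) ^ (k + 1)) -
        ((k : ℂ) + 1) * (1 + (s : ℂ) ^ 2) * (Complex.exp ((n : ℂ) * Complex.I * θ) /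
          ((s : ℂ) + Complex.I * Complex.sin θ) ^ (k + 1 + 1))) θ := by
    intro θ _
    have hD := add_I_mul_sin_ne_zero hs θ
    have hid : ∀ c : ℂ, HasDerivAt (fun θ : ℝ => Complex.exp (c * θ))
        (Complex.exp (c * θ) * c) θ := by
      intro c
      simpa using ((Complex.ofRealCLM.hasDerivAt (x := θ)).const_mul c).cexp
    have hsin : HasDerivAt (fun θ : ℝ => (s : ℂ) + Complex.I * Complex.sin θ)
        (Complex.I * Complex.cos θ) θ := by
      simpa using ((Complex.hasDerivAt_sin (θ : ℂ)).comp_ofReal.const_mul Complex.I).const_add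
        (s : ℂ)
    refine (((((hid Complex.I).add_const (s : ℂ)).const_mul (-Complex.I)).mul
      (hid ((n : ℂ) * Complex.I))).div (hsin.pow (k + 1)) (pow_ne_zero _ hD)).congr_deriv ?_
    have he : Complex.exp (((n + 1 : ℕ) : ℂ) * Complex.I * θ) =
        Complex.exp (Complex.I * θ) * Complex.exp ((n : ℂ) * Complex.I * θ) := by
      rw [← Complex.exp_add]; congr 1; push_cast; ring
    have hz : Complex.exp (Complex.I * θ) = Complex.cos θ + Complex.I * Complex.sin θ := by
      rw [mul_comm, Complex.exp_mul_I]; ring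
    simp only [Pi.mul_apply, Pi.pow_apply, Nat.add_sub_cancel, he, hz]
    have hcs := Complex.sin_sq_add_cos_sq (θ : ℂ)
    have hI := Complex.I_sq
    generalize Complex.exp ((n : ℂ) * Complex.I * θ) = e
    generalize Complex.cos (θ : ℂ) = C at *
    generalize Complex.sin (θ : ℂ) = S at *
    generalize hDd : (s : ℂ) + Complex.I * S = D at *
    have hS : Complex.I * S = D - s := by rw [← hDd]; ring
    have hC : C ^ 2 = 1 + (D - s) ^ 2 := by
      rw [← hS]; linear_combination hcs - S ^ 2 * hI
    rw [hS]
    push_cast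
    field_simp
    linear_combination (e * ((-(C + (D - s)) + -((C + (D - s) + s) * n)) * D ^ (k + 1) -
      -(C * (C + (D - s) + s) * (k + 1) * D ^ k)) * D ^ (k + 1 + 1)) * hI -
      (e * (k + 1) * D ^ k * D ^ (k + 2)) * hC
  have hFTC := intervalIntegral.integral_eq_sub_of_hasDerivAt hd ((i2.add i3).sub i1)
  rw [intervalIntegral.integral_sub (i2.add i3) i1, intervalIntegral.integral_add i2 i3] at hFTC
  simp only [intervalIntegral.integral_const_mul] at hFTC
  have p1 : Complex.exp (Complex.I * ((2 * Real.pi : ℝ) : ℂ)) = 1 := by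
    rw [← Complex.exp_two_pi_mul_I]; congr 1; push_cast; ring
  have p2 : Complex.exp ((n : ℂ) * Complex.I * ((2 * Real.pi : ℝ) : ℂ)) = 1 := by
    rw [← Complex.exp_nat_mul_two_pi_mul_I n]; congr 1; push_cast; ring
  have p3 : Complex.sin ((2 * Real.pi : ℝ) : ℂ) = 0 := by
    rw [← Complex.ofReal_sin, Real.sin_two_pi, Complex.ofReal_zero]
  rw [p1, p2, p3] at hFTC
  simp only [Complex.ofReal_zero, mul_zero, Complex.exp_zero, Complex.sin_zero, sub_self] at hFTC
  simp only [angularIntegral]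
  linear_combination -(2 * (Real.pi : ℂ))⁻¹ * hFTC
theorem laplace_integrand_integrable {s : ℝ} (hs : 0 < s) (ω : ℝ) (k n : ℕ) :
    Integrable (Function.uncurry fun x θ : ℝ =>
      Complex.exp (-(s : ℂ) * x) * (x : ℂ) ^ k * (Complex.exp ((n : ℂ) * Complex.I * θ) *
        Complex.exp (-Complex.I * ((ω * x : ℝ) : ℂ) * Complex.sin θ)))
      ((volume.restrict (Ioi 0)).prod (volume.restrict (Ioc 0 (2 * Real.pi)))) := by
  have h1 : IntegrableOn (fun x : ℝ => x ^ (k : ℝ) * Real.exp (-s * x)) (Ioi 0) := by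
    have : (-1 : ℝ) < k := by
      have : (0 : ℝ) ≤ k := by positivity
      linarith
    simpa using integrableOn_rpow_mul_exp_neg_mul_rpow (p := 1) this one_pos hs
  have h2 : Integrable (fun _ : ℝ => (1 : ℝ)) (volume.restrict (Ioc 0 (2 * Real.pi))) :=
    integrable_const _
  refine ((Integrable.norm h1).mul_prod h2).mono' (Continuous.aestronglyMeasurable ?_) (.of_forall fun p => ?_)
  · simp only [Function.uncurry_def]
    fun_prop
  · obtain ⟨x, θ⟩ := p
    simp only [Function.uncurry_apply_pair]
    have e1 : Complex.exp (-(s : ℂ) * x) = ((Real.exp (-s * x) : ℝ) : ℂ) := by push_cast; rfl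
    have e2 : -Complex.I * ((ω * x : ℝ) : ℂ) * Complex.sin θ =
        ((-(ω * x * Real.sin θ) : ℝ) : ℂ) * Complex.I := by push_cast; ring
    have e3 := norm_exp_int_mul_I n θ
    rw [Int.cast_natCast] at e3
    rw [e1, e2, norm_mul, norm_mul, norm_mul, Complex.norm_exp_ofReal_mul_I, e3, norm_pow,
      Complex.norm_real, Complex.norm_real, Real.rpow_natCast, norm_mul, norm_pow]
    simp [mul_comm]

theorem laplace_besselJ_aux {s : ℝ} (ω : ℝ) (k n : ℕ) (x : ℝ) :
    Complex.exp (-(s : ℂ) * x) * ((x : ℂ) ^ k * ((besselJ n (ω * x) : ℝ) : ℂ)) =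
      (2 * (Real.pi : ℂ))⁻¹ * ∫ θ in Ioc (0:ℝ) (2 * Real.pi),
        Complex.exp (-(s : ℂ) * x) * (x : ℂ) ^ k * (Complex.exp ((n : ℂ) * Complex.I * θ) *
        Complex.exp (-Complex.I * ((ω * x : ℝ) : ℂ) * Complex.sin θ)) := by
  rw [besselJ_eq_integral, intervalIntegral.integral_of_le Real.two_pi_pos.le, integral_const_mul]
  ring

theorem integrableOn_laplace_besselJ {s : ℝ} (hs : 0 < s) (ω : ℝ) (k n : ℕ) :
    IntegrableOn (fun x : ℝ =>
      Complex.exp (-(s : ℂ) * x) * ((x : ℂ) ^ k * ((besselJ n (ω * x) : ℝ) : ℂ))) (Ioi 0) := by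
  simp_rw [laplace_besselJ_aux]
  exact (laplace_integrand_integrable hs ω k n).integral_prod_left.const_mul _

theorem integrableOn_pow_mul_exp {r : ℂ} (hr : 0 < r.re) (k : ℕ) :
    IntegrableOn (fun x : ℝ => (x : ℂ) ^ k * Complex.exp (-r * x)) (Ioi 0) := by
  have h1 : IntegrableOn (fun x : ℝ => x ^ (k : ℝ) * Real.exp (-r.re * x)) (Ioi 0) := by
    have : (-1 : ℝ) < k := by
      have : (0 : ℝ) ≤ k := by positivity
      linarith
    simpa using integrableOn_rpow_mul_exp_neg_mul_rpow (p := 1) this one_pos hr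
  refine (Integrable.norm h1).mono' (Continuous.aestronglyMeasurable (by fun_prop))
    (.of_forall fun x => ?_)
  simp [Complex.norm_exp]

theorem integral_pow_mul_exp {r : ℂ} (hr : 0 < r.re) (k : ℕ) :
    ∫ x in Ioi (0:ℝ), (x : ℂ) ^ k * Complex.exp (-r * x) = (k.factorial : ℂ) / r ^ (k + 1) := by
  have hr0 : r ≠ 0 := by rintro rfl; simp at hr
  induction k with
  | zero =>
    have := integral_exp_mul_complex_Ioi (a := -r) (by simpa using hr) 0
    simpa [neg_div_neg_eq] using this
  | succ k ih =>
    have i1 := (integrableOn_pow_mul_exp hr k).const_mul ((k : ℂ) + 1)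
    have i2 := (integrableOn_pow_mul_exp hr (k + 1)).const_mul r
    have hd : ∀ x ∈ Ici (0:ℝ), HasDerivAt (fun x : ℝ => (x : ℂ) ^ (k + 1) * Complex.exp (-r * x))
        (((k : ℂ) + 1) * ((x : ℂ) ^ k * Complex.exp (-r * x)) -
          r * ((x : ℂ) ^ (k + 1) * Complex.exp (-r * x))) x := by
      intro x _
      have hid := Complex.ofRealCLM.hasDerivAt (x := x)
      refine ((hid.pow (k + 1)).mul (hid.const_mul (-r)).cexp).congr_deriv ?_
      simp
      ring
    have ht := tendsto_zero_of_hasDerivAt_of_integrableOn_Ioi (fun x hx => hd x (Ioi_subset_Ici_self hx))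
      (i1.sub i2) (integrableOn_pow_mul_exp hr (k + 1))
    have h := integral_Ioi_of_hasDerivAt_of_tendsto' hd (i1.sub i2) ht
    rw [integral_sub i1 i2, integral_const_mul, integral_const_mul, ih] at h
    simp only [Complex.ofReal_zero, zero_pow (Nat.succ_ne_zero k), zero_mul, sub_zero] at h
    rw [eq_div_iff (by positivity), Nat.factorial_succ]
    push_cast
    have h2 := (sub_eq_zero.1 h).symm
    rw [mul_div_assoc', eq_div_iff (by positivity)] at h2
    linear_combination h2

theorem integral_laplace_besselJ {s ω : ℝ} (hs : 0 < s) (hω : 0 < ω) (k n : ℕ) :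
    ∫ x in Ioi (0:ℝ),
      Complex.exp (-(s : ℂ) * x) * ((x : ℂ) ^ k * ((besselJ n (ω * x) : ℝ) : ℂ)) =
      ((ω : ℂ) ^ (k + 1))⁻¹ * ((k.factorial : ℂ) * angularIntegral k n (s / ω)) := by
  simp_rw [laplace_besselJ_aux]
  have hω' : (ω : ℂ) ≠ 0 := by exact_mod_cast hω.ne'
  rw [integral_const_mul, integral_integral_swap (laplace_integrand_integrable hs ω k n),
    angularIntegral, intervalIntegral.integral_of_le Real.two_pi_pos.le]
  have : ∀ θ : ℝ, ∫ x in Ioi (0:ℝ), Complex.exp (-(s : ℂ) * x) * (x : ℂ) ^ k *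
      (Complex.exp ((n : ℂ) * Complex.I * θ) *
        Complex.exp (-Complex.I * ((ω * x : ℝ) : ℂ) * Complex.sin θ)) =
      (((ω : ℂ) ^ (k + 1))⁻¹ * (k.factorial : ℂ)) * (Complex.exp ((n : ℂ) * Complex.I * θ) /
        (((s / ω : ℝ) : ℂ) + Complex.I * Complex.sin θ) ^ (k + 1)) := by
    intro θ
    have h := integral_pow_mul_exp (r := (s : ℂ) + Complex.I * (ω * Complex.sin θ))
      (by rwa [re_add_I_mul_sin]) k
    have e : (s : ℂ) + Complex.I * (ω * Complex.sin θ) =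
        ω * (((s / ω : ℝ) : ℂ) + Complex.I * Complex.sin θ) := by
      push_cast; field_simp
    calc _ = ∫ x in Ioi (0:ℝ), Complex.exp ((n : ℂ) * Complex.I * θ) * ((x : ℂ) ^ k *
          Complex.exp (-((s : ℂ) + Complex.I * (ω * Complex.sin θ)) * x)) := by
          refine integral_congr_ae (.of_forall fun x => ?_)
          have : Complex.exp (-((s : ℂ) + Complex.I * (ω * Complex.sin θ)) * x) =
            Complex.exp (-(s : ℂ) * x) *
              Complex.exp (-Complex.I * ((ω * x : ℝ) : ℂ) * Complex.sin θ) := by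
            rw [← Complex.exp_add]; congr 1; push_cast; ring
          simp only [this]
          ring
      _ = _ := by
          rw [integral_const_mul, h, e, mul_pow, div_mul_eq_div_div, div_eq_mul_inv,
            div_eq_mul_inv, div_eq_mul_inv]
          ring
  simp_rw [this]
  rw [integral_const_mul]
  ring

theorem angularIntegral_zero {s : ℝ} (hs : 0 < s) (n : ℕ) :
    angularIntegral 0 n s =
      (((Real.sqrt (1 + s ^ 2) - s) ^ n / Real.sqrt (1 + s ^ 2) : ℝ) : ℂ) := by
  set q := Real.sqrt (1 + s ^ 2) with hq
  have hq2 : q ^ 2 = 1 + s ^ 2 := Real.sq_sqrt (by positivity)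
  have hq1 : 1 < q := by
    rw [hq, Real.lt_sqrt (by norm_num)]
    nlinarith
  have hqs : s < q := by nlinarith
  have ha : (((q - s : ℝ)) : ℂ) ∈ Metric.ball (0 : ℂ) 1 := by
    rw [mem_ball_zero_iff, Complex.norm_real, Real.norm_of_nonneg (by linarith)]
    nlinarith
  have hb : ∀ z ∈ Metric.closedBall (0 : ℂ) 1, z + ((q + s : ℝ) : ℂ) ≠ 0 := by
    intro z hz h
    rw [mem_closedBall_zero_iff, eq_neg_of_add_eq_zero_left h, norm_neg, Complex.norm_real,
      Real.norm_of_nonneg (by linarith)] at hz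
    linarith
  have hd : DifferentiableOn ℂ (fun z : ℂ => 2 * z ^ n / (z + ((q + s : ℝ) : ℂ)))
      (Metric.closedBall 0 1) := by
    refine DifferentiableOn.div (by fun_prop) (by fun_prop) hb
  have h := hd.circleIntegral_sub_inv_smul ha
  rw [circleIntegral] at h
  have hcongr : ∀ θ : ℝ, deriv (circleMap 0 1) θ •
      (fun z : ℂ => (z - ((q - s : ℝ) : ℂ))⁻¹ • (2 * z ^ n / (z + ((q + s : ℝ) : ℂ))))
        (circleMap 0 1 θ) =
      Complex.I * (Complex.exp ((n : ℂ) * Complex.I * θ) /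
        ((s : ℂ) + Complex.I * Complex.sin θ) ^ (0 + 1)) := by
    intro θ
    have hD := add_I_mul_sin_ne_zero hs θ
    have hz : circleMap 0 1 θ = Complex.exp (θ * Complex.I) := by simp [circleMap]
    have hn : Complex.exp ((n : ℂ) * Complex.I * θ) = Complex.exp (θ * Complex.I) ^ n := by
      rw [← Complex.exp_nat_mul]; congr 1; ring
    have hne := Complex.exp_ne_zero (θ * Complex.I)
    have hfac : (Complex.exp (θ * Complex.I) - ((q - s : ℝ) : ℂ)) *
        (Complex.exp (θ * Complex.I) + ((q + s : ℝ) : ℂ)) =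
        2 * Complex.exp (θ * Complex.I) * ((s : ℂ) + Complex.I * Complex.sin θ) := by
      have hq2' : (q : ℂ) ^ 2 = 1 + (s : ℂ) ^ 2 := by exact_mod_cast hq2
      have hcs := Complex.sin_sq_add_cos_sq (θ : ℂ)
      rw [Complex.exp_mul_I]
      push_cast
      linear_combination -hq2' + hcs - Complex.sin θ ^ 2 * Complex.I_sq
    simp only [deriv_circleMap, hz, hn, smul_eq_mul, zero_add, pow_one]
    rw [← div_eq_inv_mul, div_div, mul_comm (_ + _), hfac]
    field_simp
  simp_rw [hcongr] at h
  rw [intervalIntegral.integral_const_mul] at h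
  have hI : (∫ θ in (0:ℝ)..(2 * Real.pi), Complex.exp ((n : ℂ) * Complex.I * θ) /
        ((s : ℂ) + Complex.I * Complex.sin θ) ^ (0 + 1)) =
      2 * Real.pi * (((q - s) ^ n / q : ℝ) : ℂ) := by
    apply mul_left_cancel₀ Complex.I_ne_zero
    rw [h]
    have : (q : ℂ) ≠ 0 := by exact_mod_cast (by linarith : q ≠ 0)
    simp only [smul_eq_mul]
    rw [show ((q - s : ℝ) : ℂ) + ((q + s : ℝ) : ℂ) = 2 * q by push_cast; ring]
    push_cast
    field_simp
  rw [angularIntegral, hI]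
  have : (Real.pi : ℂ) ≠ 0 := by exact_mod_cast Real.pi_ne_zero
  field_simp

/-- The Abel moments `2^k Γ((ν+k+1)/2) / Γ((ν-k+1)/2)` of the Bessel function. -/
def besselMoment (k n : ℕ) : ℝ :=
  2 ^ k * Real.Gamma (((n : ℝ) + k + 1) / 2) / Real.Gamma (((n : ℝ) - k + 1) / 2)

theorem besselMoment_zero (n : ℕ) : besselMoment 0 n = 1 := by
  have : 0 < Real.Gamma (((n : ℝ) + 1) / 2) := Real.Gamma_pos_of_pos (by positivity)
  simp [besselMoment, this.ne']

theorem besselMoment_succ (k n : ℕ) :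
    besselMoment (k + 1) n = ((n : ℝ) - k) * besselMoment k (n + 1) := by
  simp only [besselMoment]
  push_cast
  rw [show ((n : ℝ) + 1 + k + 1) / 2 = (n + (k + 1) + 1) / 2 by ring,
    show ((n : ℝ) + 1 - k + 1) / 2 = (n - (k + 1) + 1) / 2 + 1 by ring]
  by_cases h : ((n : ℝ) - (k + 1) + 1) / 2 = 0
  · have : (n : ℝ) - k = 0 := by linarith
    rw [this, h, Real.Gamma_zero]
    simp
  · rw [Real.Gamma_add_one h]
    have hk : (n : ℝ) - k = 2 * (((n : ℝ) - (k + 1) + 1) / 2) := by ring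
    rw [hk, pow_succ]
    generalize ((n : ℝ) - (k + 1) + 1) / 2 = t at *
    field_simp

theorem tendsto_angularIntegral (k n : ℕ) :
    Tendsto (fun s : ℝ => (k.factorial : ℂ) * angularIntegral k n s) (nhdsWithin 0 (Ioi 0))
      (nhds (besselMoment k n : ℂ)) := by
  induction k generalizing n with
  | zero =>
    have hc : ContinuousAt (fun s : ℝ =>
        (((Real.sqrt (1 + s ^ 2) - s) ^ n / Real.sqrt (1 + s ^ 2) : ℝ) : ℂ)) 0 := by
      refine Complex.continuous_ofReal.continuousAt.comp (ContinuousAt.div ?_ ?_ (by simp))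
      · fun_prop
      · fun_prop
    have h := hc.tendsto.mono_left (nhdsWithin_le_nhds (s := Ioi 0))
    simp only [besselMoment_zero]
    refine Tendsto.congr' ?_ (by simpa using h)
    filter_upwards [self_mem_nhdsWithin] with s hs
    simp [angularIntegral_zero hs]
  | succ k ih =>
    have hs0 : Tendsto (fun s : ℝ => (s : ℂ)) (nhdsWithin 0 (Ioi 0)) (nhds 0) :=
      (Complex.continuous_ofReal.tendsto' 0 0 (by simp)).mono_left nhdsWithin_le_nhds
    have hnum := ((ih (n + 1)).const_mul ((n : ℂ) - k)).add
      ((hs0.mul_const ((n : ℂ) + k + 1)).mul (ih n))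
    have h := hnum.div ((hs0.pow 2).const_add 1) (by simp)
    have hval : (((n : ℂ) - k) * (besselMoment k (n + 1) : ℂ) +
        0 * ((n : ℂ) + k + 1) * (besselMoment k n : ℂ)) / (1 + 0 ^ 2) =
        (besselMoment (k + 1) n : ℂ) := by
      rw [besselMoment_succ]; push_cast; ring
    rw [hval] at h
    refine h.congr' ?_
    filter_upwards [self_mem_nhdsWithin] with s hs
    have hne : (1 + (s : ℂ) ^ 2) ≠ 0 := by exact_mod_cast (by positivity : (1 + s ^ 2) ≠ 0)
    simp only [Pi.div_apply]
    rw [div_eq_iff hne, Nat.factorial_succ]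
    push_cast
    linear_combination -(k.factorial : ℂ) * angularIntegral_succ hs k n

theorem hasAbelLimit_pow_mul_besselJ {ω : ℝ} (hω : 0 < ω) (k n : ℕ) :
    HasAbelLimit (fun x : ℝ => (x : ℂ) ^ k * ((besselJ n (ω * x) : ℝ) : ℂ))
      (((ω : ℂ) ^ (k + 1))⁻¹ * (besselMoment k n : ℂ)) := by
  refine ⟨fun s hs => integrableOn_laplace_besselJ hs ω k n, ?_⟩
  have hdiv : Tendsto (fun s : ℝ => s / ω) (nhdsWithin 0 (Ioi 0)) (nhdsWithin 0 (Ioi 0)) := by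
    refine tendsto_nhdsWithin_iff.2 ⟨?_, ?_⟩
    · exact ((continuous_id.div_const ω).tendsto' 0 0 (by simp)).mono_left nhdsWithin_le_nhds
    · filter_upwards [self_mem_nhdsWithin] with s hs using div_pos hs hω
  refine Tendsto.congr' ?_ (((tendsto_angularIntegral k n).comp hdiv).const_mul _)
  filter_upwards [self_mem_nhdsWithin] with s hs
  exact (integral_laplace_besselJ hs hω k n).symm

theorem HasAbelLimit.add {g h : ℝ → ℂ} {L M : ℂ} (hg : HasAbelLimit g L) (hh : HasAbelLimit h M) :
    HasAbelLimit (fun x => g x + h x) (L + M) := by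
  refine ⟨fun s hs => ?_, ?_⟩
  · simp_rw [mul_add]
    exact (hg.1 s hs).add (hh.1 s hs)
  · refine (hg.2.add hh.2).congr' ?_
    filter_upwards [self_mem_nhdsWithin] with s hs
    simp_rw [mul_add]
    exact (integral_add (hg.1 s hs) (hh.1 s hs)).symm

theorem HasAbelLimit.const_mul {g : ℝ → ℂ} {L : ℂ} (hg : HasAbelLimit g L) (c : ℂ) :
    HasAbelLimit (fun x => c * g x) (c * L) := by
  refine ⟨fun s hs => ?_, ?_⟩
  · simp_rw [mul_left_comm _ c]
    exact (hg.1 s hs).const_mul c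
  · refine (hg.2.const_mul c).congr fun s => ?_
    simp_rw [mul_left_comm _ c]
    exact (integral_const_mul c _).symm

theorem iteratedDeriv_eval_zero (f : ℂ[X]) (k : ℕ) :
    iteratedDeriv k (fun z => f.eval z) 0 = (k.factorial : ℂ) * f.coeff k := by
  have h : ∀ k : ℕ, iteratedDeriv k (fun z => f.eval z) = fun z => (derivative^[k] f).eval z := by
    intro k
    induction k with
    | zero => simp
    | succ k ih =>
      rw [iteratedDeriv_succ, ih]
      ext z
      rw [Polynomial.deriv, Function.iterate_succ_apply']
  rw [h]
  change (derivative^[k] f).eval 0 = _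
  rw [← coeff_zero_eq_eval_zero, coeff_iterate_derivative, zero_add, Nat.descFactorial_self,
    nsmul_eq_mul]

theorem QRule_add (μ ν : ℕ) {n : ℕ} (xs ws : Fin n → ℝ) (f g : ℂ[X]) (ω : ℝ) :
    QRule μ ν xs ws (fun z => (f + g).eval z) ω =
      QRule μ ν xs ws (fun z => f.eval z) ω + QRule μ ν xs ws (fun z => g.eval z) ω := by
  simp only [QRule, iteratedDeriv_eval_zero, coeff_add]
  simp only [eval_add, mul_add, Finset.sum_add_distrib]
  ring

theorem exp_mul_pow_add_exp_mul_pow (ν k : ℕ) (y : ℂ) :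
    Complex.exp (-(ν : ℂ) * (Real.pi : ℂ) * Complex.I / 2) * (Complex.I * y) ^ k +
      Complex.exp ((ν : ℂ) * (Real.pi : ℂ) * Complex.I / 2) * (-Complex.I * y) ^ k =
      2 * ((Real.cos (((k : ℝ) - ν) * Real.pi / 2) : ℝ) : ℂ) * y ^ k := by
  have hI : Complex.I = Complex.exp (Real.pi / 2 * Complex.I) := Complex.exp_pi_div_two_mul_I.symm
  have hI' : -Complex.I = Complex.exp (-(Real.pi / 2 * Complex.I)) := by
    rw [Complex.exp_neg, ← hI, Complex.inv_I]
  have e1 : Complex.exp (-(ν : ℂ) * (Real.pi : ℂ) * Complex.I / 2) * Complex.I ^ k =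
      Complex.exp ((((k : ℝ) - ν) * Real.pi / 2 : ℝ) * Complex.I) := by
    nth_rewrite 2 [hI]
    rw [← Complex.exp_nat_mul, ← Complex.exp_add]
    congr 1; push_cast; ring
  have e2 : Complex.exp ((ν : ℂ) * (Real.pi : ℂ) * Complex.I / 2) * (-Complex.I) ^ k =
      Complex.exp (-((((k : ℝ) - ν) * Real.pi / 2 : ℝ) : ℂ) * Complex.I) := by
    rw [hI', ← Complex.exp_nat_mul, ← Complex.exp_add]
    congr 1; push_cast; ring
  rw [mul_pow, mul_pow, ← mul_assoc, ← mul_assoc, e1, e2, ← add_mul, Complex.ofReal_cos,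
    Complex.cos]
  ring

theorem kappaQ_of_odd {μ ν : ℕ} (hodd : Odd (μ - ν)) : kappaQ μ ν = μ + 1 :=
  if_neg (Nat.not_even_iff_odd.2 hodd)

/-- The Bessel moments of order at least `μ` are reproduced by the interior nodes. -/
theorem besselMoment_eq_sum {ν μ n : ℕ} (hνμ : ν < μ) (hodd : Odd (μ - ν))
    {xs ws : Fin n → ℝ} (hG : IsGaussRule (μ : ℝ) (ν : ℝ) n xs ws) {k : ℕ} (hμk : μ ≤ k)
    (hk : k ≤ 4 * n + μ) :
    besselMoment k ν = 2 / Real.pi * Real.cos (((k : ℝ) - ν) * Real.pi / 2) *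
      ∑ j, ws j * (xs j) ^ (((k : ℝ) - kappaQ μ ν) / 2) := by
  obtain ⟨-, -, -, hexact⟩ := hG
  obtain ⟨t, ht⟩ := hodd
  have hκ := kappaQ_of_odd (μ := μ) (ν := ν) ⟨t, ht⟩
  rcases Nat.even_or_odd' (k - ν) with ⟨l, hl | hl⟩
  · obtain ⟨m, hm⟩ : ∃ m, k = μ + 1 + 2 * m := ⟨l - t - 1, by omega⟩
    have hkl : k = ν + 2 * l := by omega
    have hsum : ∑ j, ws j * (xs j) ^ (((k : ℝ) - kappaQ μ ν) / 2) =
        2 ^ (ν + 2 * l) / 2 * Real.Gamma (l + 1 / 2) * Real.Gamma (ν + l + 1 / 2) := by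
      rw [← moment_weightW ν μ m ⟨t, ht⟩ l (by omega)]
      have h := hexact (X ^ m) (by rw [natDegree_X_pow]; omega)
      simp only [eval_pow, eval_X] at h
      rw [← h]
      refine Finset.sum_congr rfl fun j _ => ?_
      rw [hκ, hm, ← Real.rpow_natCast]
      congr 2
      push_cast
      ring
    have hkr : (k : ℝ) = ν + 2 * l := by exact_mod_cast hkl
    have hrefl := Real.Gamma_mul_Gamma_one_sub ((l : ℝ) + 1 / 2)
    rw [show Real.pi * ((l : ℝ) + 1 / 2) = l * Real.pi + Real.pi / 2 by ring,
      Real.sin_add_pi_div_two] at hrefl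
    have hcos : Real.cos (l * Real.pi) ^ 2 = 1 := by
      have := Real.sin_sq_add_cos_sq (l * Real.pi)
      rw [Real.sin_nat_mul_pi] at this
      linarith
    have hcos0 : Real.cos (l * Real.pi) ≠ 0 := by
      intro h0; rw [h0] at hcos; norm_num at hcos
    have hΓ : Real.Gamma (1 - ((l : ℝ) + 1 / 2)) ≠ 0 := by
      intro h0
      rw [h0, mul_zero] at hrefl
      exact div_ne_zero Real.pi_ne_zero hcos0 hrefl.symm
    rw [hsum, besselMoment, hkr, hkl,
      show ((ν : ℝ) + (ν + 2 * l) + 1) / 2 = ν + l + 1 / 2 by ring,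
      show ((ν : ℝ) - (ν + 2 * l) + 1) / 2 = 1 - (l + 1 / 2) by ring,
      show ((ν : ℝ) + 2 * l - ν) * Real.pi / 2 = l * Real.pi by ring,
      div_eq_iff hΓ]
    rw [eq_div_iff hcos0] at hrefl
    have hpi := Real.pi_ne_zero
    generalize Real.Gamma (1 - ((l : ℝ) + 1 / 2)) = a at *
    generalize Real.Gamma ((l : ℝ) + 1 / 2) = b at *
    generalize Real.Gamma ((ν : ℝ) + l + 1 / 2) = c at *
    linear_combination (-(2 ^ (ν + 2 * l) * c * Real.pi⁻¹)) * hrefl -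
      2 ^ (ν + 2 * l) * c * mul_inv_cancel₀ hpi
  · have hkr : (k : ℝ) = ν + (2 * l + 1) := by exact_mod_cast (by omega : k = ν + (2 * l + 1))
    have hcos : Real.cos (((k : ℝ) - ν) * Real.pi / 2) = 0 := by
      rw [Real.cos_eq_zero_iff]
      exact ⟨l, by rw [hkr]; push_cast; ring⟩
    rw [hcos, besselMoment, hkr, show ((ν : ℝ) - (ν + (2 * l + 1)) + 1) / 2 = -(l : ℝ) by ring,
      Real.Gamma_neg_nat_eq_zero]
    simp

theorem QRule_monomial {ν μ n : ℕ} (hνμ : ν < μ) (hodd : Odd (μ - ν))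
    {xs ws : Fin n → ℝ} (hG : IsGaussRule (μ : ℝ) (ν : ℝ) n xs ws) {k : ℕ}
    (hk : k ≤ 4 * n + μ) (r : ℂ) {ω : ℝ} (hω : 0 < ω) :
    QRule μ ν xs ws (fun z => (C r * X ^ k : ℂ[X]).eval z) ω =
      r * (((ω : ℂ) ^ (k + 1))⁻¹ * (besselMoment k ν : ℂ)) := by
  have hω' : (ω : ℂ) ≠ 0 := by exact_mod_cast hω.ne'
  have hnodes : ∀ j, ((ws j * (xs j) ^ (-(kappaQ μ ν) / 2) / Real.pi : ℝ) : ℂ) *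
      (Complex.exp (-(ν : ℂ) * (Real.pi : ℂ) * Complex.I / 2) *
          (r * (Complex.I * (Real.sqrt (xs j) : ℂ) / (ω : ℂ)) ^ k) +
        Complex.exp ((ν : ℂ) * (Real.pi : ℂ) * Complex.I / 2) *
          (r * (-Complex.I * (Real.sqrt (xs j) : ℂ) / (ω : ℂ)) ^ k)) =
      r / (ω : ℂ) ^ k * ((2 / Real.pi * Real.cos (((k : ℝ) - ν) * Real.pi / 2) : ℝ) : ℂ) *
        ((ws j * (xs j) ^ (((k : ℝ) - kappaQ μ ν) / 2) : ℝ) : ℂ) := by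
    intro j
    have hx := hG.2.1 j
    have hpow : (xs j) ^ (((k : ℝ) - kappaQ μ ν) / 2) =
        (xs j) ^ (-(kappaQ μ ν) / 2) * Real.sqrt (xs j) ^ k := by
      rw [Real.sqrt_eq_rpow, ← Real.rpow_mul_natCast hx.le, ← Real.rpow_add hx]
      congr 1; ring
    have h := exp_mul_pow_add_exp_mul_pow ν k ((Real.sqrt (xs j) : ℂ) / (ω : ℂ))
    rw [← mul_div_assoc, ← mul_div_assoc, div_pow (Real.sqrt (xs j) : ℂ)] at h
    rw [hpow]
    push_cast at h ⊢
    linear_combination (r * (ws j * ((xs j ^ (-(kappaQ μ ν) / 2) : ℝ) : ℂ) / Real.pi)) * h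
  simp only [QRule, iteratedDeriv_eval_zero, coeff_C_mul_X_pow]
  simp only [eval_mul, eval_C, eval_pow, eval_X]
  simp_rw [hnodes]
  rw [← Finset.mul_sum, ← Complex.ofReal_sum]
  simp only [mul_ite, mul_zero, Finset.sum_ite_eq', Finset.mem_range]
  split_ifs with hkμ
  · have hfac : (k.factorial : ℝ) ≠ 0 := by positivity
    have hw : wHat0 μ ν xs ws k * k.factorial =
        besselMoment k ν - 2 / Real.pi * Real.cos (((k : ℝ) - ν) * Real.pi / 2) *
          ∑ j, ws j * (xs j) ^ (((k : ℝ) - kappaQ μ ν) / 2) := by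
      rw [wHat0, besselMoment]
      field_simp
    have hw' : (wHat0 μ ν xs ws k : ℂ) * (k.factorial : ℂ) = (besselMoment k ν : ℂ) -
        ((2 / Real.pi * Real.cos (((k : ℝ) - ν) * Real.pi / 2) : ℝ) : ℂ) *
          ((∑ j, ws j * (xs j) ^ (((k : ℝ) - kappaQ μ ν) / 2) : ℝ) : ℂ) := by
      exact_mod_cast hw
    rw [pow_succ, mul_inv]
    linear_combination (1 / (ω : ℂ) * r / (ω : ℂ) ^ k) * hw'
  · rw [besselMoment_eq_sum hνμ hodd hG (not_lt.1 hkμ) hk, pow_succ, mul_inv]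
    push_cast
    ring

/-- exactness of the generalized Gauss–Radau rule, `μ - ν` odd. -/
theorem gaussRadau_exact_odd (ν μ n : ℕ) (hνμ : ν < μ) (hodd : Odd (μ - ν)) (hn : 1 ≤ n)
    (xs ws : Fin n → ℝ) (hG : IsGaussRule (μ : ℝ) (ν : ℝ) n xs ws)
    (f : Polynomial ℂ) (hdeg : f.natDegree ≤ 4 * n + μ) (ω : ℝ) (hω : 0 < ω) :
    HasAbelLimit (fun x : ℝ => f.eval (x : ℂ) * ((besselJ ν (ω * x) : ℝ) : ℂ))
      (QRule μ ν xs ws (fun z => f.eval z) ω) := by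
  have hmono : ∀ (k : ℕ) (r : ℂ), k ≤ 4 * n + μ →
      HasAbelLimit (fun x : ℝ => (C r * X ^ k : ℂ[X]).eval (x : ℂ) *
        ((besselJ ν (ω * x) : ℝ) : ℂ))
        (QRule μ ν xs ws (fun z => (C r * X ^ k : ℂ[X]).eval z) ω) := by
    intro k r hk
    rw [QRule_monomial hνμ hodd hG hk r hω]
    simpa [mul_assoc] using (hasAbelLimit_pow_mul_besselJ hω k ν).const_mul r
  refine induction_with_natDegree_le
    (fun f => HasAbelLimit (fun x : ℝ => f.eval (x : ℂ) * ((besselJ ν (ω * x) : ℝ) : ℂ))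
      (QRule μ ν xs ws (fun z => f.eval z) ω))
    (4 * n + μ) ?_ (fun k r _ hk => hmono k r hk) ?_ f hdeg
  · simpa using hmono 0 0 (Nat.zero_le _)
  · intro f g _ _ hf hg
    rw [QRule_add]
    simp_rw [eval_add, add_mul]
    exact hf.add hg

end
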